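/- (Risk certificate via the inverted kl bound, Eq. (41).) Fix a measurable loss l : W × Z → [0,1], a sample size n ≥ 1, a confidence level δ ∈ (0,1), and a data-free (prior) probability measure P on W. Then with probability at least 1−δ over the draw of S = (z₁,…,zₙ) i.i.d. from D, simultaneously for all probability measures Q on W: L(Q) ≤ kl⁻¹( L̂_S(Q), (KL(Q∥P) + log(2√n/δ))/n ). -/

import Mathlib

open MeasureTheory Real ENNReal Classical

/-- KL divergence between Bernoulli(q) and Bernoulli(p), with the conventions
`0 * log 0 = 0` and value `⊤` when `p ∈ {0,1}` and `q ≠ p`. -/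
noncomputable def bernKL (q p : ℝ) : ℝ≥0∞ :=
  if (p = 0 ∧ q ≠ 0) ∨ (p = 1 ∧ q ≠ 1) then ⊤
  else ENNReal.ofReal (q * Real.log (q / p) + (1 - q) * Real.log ((1 - q) / (1 - p)))

/-- Inverse Bernoulli KL: `kl⁻¹(x, b) = sup { y ∈ [x,1] : kl(x‖y) ≤ b }`. -/
noncomputable def klInv (x : ℝ) (b : ℝ≥0∞) : ℝ :=
  sSup {y : ℝ | y ∈ Set.Icc x 1 ∧ bernKL x y ≤ b}

/-- KL divergence between probability measures, `⊤` when `Q` is not absolutely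
continuous with respect to `P` (or the log-likelihood ratio is not integrable). -/
noncomputable def KLdiv {W : Type*} [MeasurableSpace W] (Q P : Measure W) : ℝ≥0∞ :=
  if Q ≪ P ∧ Integrable (llr Q P) Q then ENNReal.ofReal (∫ w, llr Q P w ∂Q) else ⊤

/-- The Krichevsky–Trofimov probability of a binary word with `a` ones and `b` zeros. -/
noncomputable def ktProb (a b : ℕ) : ℝ :=
  (∏ i ∈ Finset.range a, ((i : ℝ) + 1 / 2)) * (∏ i ∈ Finset.range b, ((i : ℝ) + 1 / 2)) /
    (a + b).factorial

lemma ktProb_pos (a b : ℕ) : 0 < ktProb a b := by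
  unfold ktProb
  have h (c : ℕ) : 0 < ∏ i ∈ Finset.range c, ((i : ℝ) + 1 / 2) :=
    Finset.prod_pos fun i _ => by positivity
  have := h a
  have := h b
  positivity

lemma ktProb_comm (a b : ℕ) : ktProb a b = ktProb b a := by
  unfold ktProb
  rw [mul_comm, add_comm a b]

lemma ktProb_succ_right (a b : ℕ) :
    ktProb a (b + 1) = ktProb a b * (((b : ℝ) + 1 / 2) / ((a + b : ℕ) + 1)) := by
  unfold ktProb
  rw [Finset.prod_range_succ, ← add_assoc, Nat.factorial_succ, Nat.cast_mul, Nat.cast_succ,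
    div_mul_div_comm]
  congr 1 <;> ring

lemma ktProb_succ_add (a b : ℕ) : ktProb a (b + 1) + ktProb (a + 1) b = ktProb a b := by
  rw [ktProb_succ_right, ktProb_comm (a + 1), ktProb_succ_right, ktProb_comm b a]
  have : ((a : ℝ) + b + 1) ≠ 0 := by positivity
  have : ((b : ℝ) + a + 1) ≠ 0 := by positivity
  push_cast
  field_simp
  ring

lemma sum_powerset_ktProb {ι : Type*} [DecidableEq ι] (s : Finset ι) :
    ∑ t ∈ s.powerset, ktProb t.card (s.card - t.card) = 1 := by
  induction s using Finset.induction_on with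
  | empty => simp [ktProb]
  | insert a s ha ih =>
    rw [Finset.sum_powerset_insert ha, ← Finset.sum_add_distrib, ← ih]
    refine Finset.sum_congr rfl fun t ht => ?_
    have hts := Finset.mem_powerset.mp ht
    have hcard := Finset.card_le_card hts
    rw [Finset.card_insert_of_notMem ha, Finset.card_insert_of_notMem fun h => ha (hts h),
      Nat.add_sub_add_right, Nat.succ_sub hcard, ktProb_succ_add]

lemma log_le_log_add_div {x m : ℝ} (hx : 0 < x) (hm : 0 < m) :
    Real.log x ≤ Real.log m + (x - m) / m := by
  have h := Real.log_le_sub_one_of_pos (div_pos hx hm)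
  rw [Real.log_div hx.ne' hm.ne'] at h
  have : (x - m) / m = x / m - 1 := by field_simp
  linarith

lemma succ_mul_log_sub_le (b : ℕ) :
    ((b : ℝ) + 1) * Real.log (b + 1) - b * Real.log b ≤ 1 + Real.log (b + 1 / 2) := by
  rcases Nat.eq_zero_or_pos b with rfl | hb
  · have h := Real.log_two_lt_d9
    simp only [CharP.cast_eq_zero, zero_add, one_div, Real.log_inv, Real.log_one]
    linarith
  have hb' : (0 : ℝ) < b := by exact_mod_cast hb
  have hm : (0 : ℝ) < b + 1 / 2 := by positivity
  have h := intervalIntegral.integral_mono_on (μ := volume) (a := (b : ℝ)) (b := b + 1)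
    (f := Real.log)
    (g := fun x => Real.log (b + 1 / 2) + (x - (b + 1 / 2)) / (b + 1 / 2)) (by linarith)
    intervalIntegral.intervalIntegrable_log' (Continuous.intervalIntegrable (by fun_prop) _ _)
    (fun x hx => log_le_log_add_div (lt_of_lt_of_le hb' hx.1) hm)
  rw [integral_log, intervalIntegral.integral_add
    (Continuous.intervalIntegrable (by fun_prop) _ _)
    (Continuous.intervalIntegrable (by fun_prop) _ _), intervalIntegral.integral_div,
    intervalIntegral.integral_sub (Continuous.intervalIntegrable (by fun_prop) _ _)
    (Continuous.intervalIntegrable (by fun_prop) _ _)] at h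
  simp only [intervalIntegral.integral_const, integral_id, smul_eq_mul] at h
  have h0 : (((b : ℝ) + 1) ^ 2 - (b : ℝ) ^ 2) / 2 - ((b : ℝ) + 1 - b) * (b + 1 / 2) = 0 := by ring
  rw [h0, zero_div, add_sub_cancel_left] at h
  linarith

lemma one_le_mul_log_sub {n : ℕ} (hn : 0 < n) :
    1 ≤ ((n : ℝ) + 1 / 2) * (Real.log (n + 1) - Real.log n) := by
  have hn' : (0 : ℝ) < n := by exact_mod_cast hn
  have h := Real.le_log_one_add_of_nonneg (x := (n : ℝ)⁻¹) (by positivity)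
  have h1 : 1 + (n : ℝ)⁻¹ = (n + 1) / n := by field_simp
  rw [h1, Real.log_div (by positivity) hn'.ne'] at h
  have h2 : 2 * (n : ℝ)⁻¹ / ((n : ℝ)⁻¹ + 2) = 1 / (n + 1 / 2) := by
    field_simp
    ring
  rw [h2, div_le_iff₀ (by positivity)] at h
  linarith

/-- The gap, in logarithmic form, between the maximum likelihood of a binary word and
`2 √n` times its Krichevsky–Trofimov probability. -/
noncomputable def ktGap (a b : ℕ) : ℝ :=
  Real.log 2 + Real.log (a + b : ℕ) / 2 + Real.log (ktProb a b) -
    (a * Real.log a + b * Real.log b - (a + b : ℕ) * Real.log (a + b : ℕ))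

lemma ktGap_comm (a b : ℕ) : ktGap a b = ktGap b a := by
  unfold ktGap
  rw [ktProb_comm, add_comm a b]
  ring

lemma ktGap_le_succ_right {a b : ℕ} (h : 0 < a + b) : ktGap a b ≤ ktGap a (b + 1) := by
  have h1 := succ_mul_log_sub_le b
  have h2 := one_le_mul_log_sub h
  unfold ktGap
  have hb : (0 : ℝ) < b + 1 / 2 := by positivity
  have hs : (0 : ℝ) < (a + b : ℕ) + 1 := by positivity
  rw [ktProb_succ_right, Real.log_mul (ktProb_pos a b).ne' (div_pos hb hs).ne',
    Real.log_div hb.ne' hs.ne', ← Nat.add_assoc,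
    Nat.cast_add (a + b) 1, Nat.cast_add b 1, Nat.cast_one]
  linarith

lemma ktGap_nonneg {a b : ℕ} (h : 0 < a + b) : 0 ≤ ktGap a b := by
  have base (b : ℕ) (hb : 0 < b) : 0 ≤ ktGap 0 b := by
    induction b, hb using Nat.le_induction with
    | base => simp [ktGap, ktProb]
    | succ b hb ih => exact ih.trans (ktGap_le_succ_right (by omega))
  rcases Nat.eq_zero_or_pos a with rfl | ha
  · exact base b (by omega)
  clear h
  induction b with
  | zero => exact ktGap_comm 0 a ▸ base a ha
  | succ b ih => exact ih.trans (ktGap_le_succ_right (by omega))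

lemma mul_log_mul_le {a n : ℕ} {t : ℝ} (ht : 0 < t) (hn : 0 < n) :
    (a : ℝ) * Real.log t + a * Real.log n - a * Real.log a ≤ t * n - a := by
  rcases Nat.eq_zero_or_pos a with rfl | ha
  · simp only [CharP.cast_eq_zero]
    have : 0 ≤ t * n := by positivity
    linarith
  have ha' : (0 : ℝ) < a := by exact_mod_cast ha
  have hn' : (0 : ℝ) < n := by exact_mod_cast hn
  have h := Real.log_le_sub_one_of_pos (x := t * n / a) (by positivity)
  rw [Real.log_div (by positivity) ha'.ne', Real.log_mul ht.ne' hn'.ne'] at h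
  have h2 := mul_le_mul_of_nonneg_left h ha'.le
  have h3 : (a : ℝ) * (t * n / a - 1) = t * n - a := by field_simp
  linarith

lemma pow_mul_pow_le_ktProb_of_pos {a b : ℕ} (h : 0 < a + b) {t u : ℝ} (ht : 0 < t) (hu : 0 < u)
    (htu : t + u = 1) : t ^ a * u ^ b ≤ 2 * Real.sqrt (a + b : ℕ) * ktProb a b := by
  have hk := ktProb_pos a b
  have hs : (0 : ℝ) < (a + b : ℕ) := by exact_mod_cast h
  rw [← Real.log_le_log_iff (by positivity) (by positivity), Real.log_mul (by positivity) hk.ne',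
    Real.log_mul (by positivity) (by positivity), Real.log_mul (by positivity) (by positivity),
    Real.log_sqrt hs.le, Real.log_pow, Real.log_pow]
  have h1 := ktGap_nonneg h
  have h2 := mul_log_mul_le (a := a) ht h
  have h3 := mul_log_mul_le (a := b) hu h
  unfold ktGap at h1
  have h4 : t * (a + b : ℕ) + u * (a + b : ℕ) = (a : ℝ) + b := by
    rw [← add_mul, htu]
    push_cast
    ring
  have h5 : ((a + b : ℕ) : ℝ) * Real.log (a + b : ℕ) =
      a * Real.log (a + b : ℕ) + b * Real.log (a + b : ℕ) := by
    rw [Nat.cast_add]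
    ring
  linarith

lemma pow_mul_pow_le_ktProb {a b : ℕ} (h : 0 < a + b) {t : ℝ} (ht : t ∈ Set.Icc (0 : ℝ) 1) :
    t ^ a * (1 - t) ^ b ≤ 2 * Real.sqrt (a + b : ℕ) * ktProb a b := by
  have hc : IsClosed {t : ℝ | t ^ a * (1 - t) ^ b ≤ 2 * Real.sqrt (a + b : ℕ) * ktProb a b} :=
    isClosed_le (by fun_prop) continuous_const
  have hsub : Set.Ioo (0 : ℝ) 1 ⊆
      {t : ℝ | t ^ a * (1 - t) ^ b ≤ 2 * Real.sqrt (a + b : ℕ) * ktProb a b} := fun t ht =>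
    pow_mul_pow_le_ktProb_of_pos h ht.1 (sub_pos.mpr ht.2) (by ring)
  have := hc.closure_subset_iff.mpr hsub
  rw [closure_Ioo (by norm_num)] at this
  exact this ht

/-- The cumulant generating function of the Bernoulli distribution with parameter `p`. -/
noncomputable def bernCgf (p t : ℝ) : ℝ := Real.log (1 - p + p * Real.exp t)

lemma bernMgf_pos {p : ℝ} (hp : p ∈ Set.Icc (0 : ℝ) 1) (t : ℝ) : 0 < 1 - p + p * Real.exp t := by
  rcases eq_or_lt_of_le hp.1 with rfl | h
  · norm_num
  · have := mul_pos h (Real.exp_pos t)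
    linarith [hp.2]

lemma exp_bernCgf {p : ℝ} (hp : p ∈ Set.Icc (0 : ℝ) 1) (t : ℝ) :
    Real.exp (bernCgf p t) = 1 - p + p * Real.exp t :=
  Real.exp_log (bernMgf_pos hp t)

lemma abs_bernCgf_le {p : ℝ} (hp : p ∈ Set.Icc (0 : ℝ) 1) (t : ℝ) : |bernCgf p t| ≤ |t| := by
  have key : Real.exp (-|t|) ≤ 1 - p + p * Real.exp t ∧
      1 - p + p * Real.exp t ≤ Real.exp |t| := by
    have h1 : Real.exp (-|t|) ≤ Real.exp t := Real.exp_le_exp.mpr (neg_abs_le t)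
    have h2 : Real.exp t ≤ Real.exp |t| := Real.exp_le_exp.mpr (le_abs_self t)
    have h3 : Real.exp (-|t|) ≤ 1 := Real.exp_le_one_iff.mpr (by simp)
    have h4 : 1 ≤ Real.exp |t| := Real.one_le_exp (abs_nonneg t)
    constructor
    · nlinarith [mul_le_mul_of_nonneg_left h1 hp.1,
        mul_le_mul_of_nonneg_left h3 (sub_nonneg.mpr hp.2)]
    · nlinarith [mul_le_mul_of_nonneg_left h2 hp.1,
        mul_le_mul_of_nonneg_left h4 (sub_nonneg.mpr hp.2)]
  rw [abs_le]
  exact ⟨(Real.le_log_iff_exp_le (bernMgf_pos hp t)).mpr key.1,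
    (Real.log_le_iff_le_exp (bernMgf_pos hp t)).mpr key.2⟩

lemma continuous_bernCgf {p : ℝ} (hp : p ∈ Set.Icc (0 : ℝ) 1) : Continuous (bernCgf p) :=
  Continuous.log (by fun_prop) fun t => (bernMgf_pos hp t).ne'

/-- The exponential of `n` times the Bernoulli relative entropy of `s / n` with respect to `p`,
as a supremum of exponentials over rational tilting parameters. -/
noncomputable def expSup (n : ℕ) (p s : ℝ) : ℝ≥0∞ :=
  ⨆ t : ℚ, ENNReal.ofReal (Real.exp (t * s - n * bernCgf p t))

lemma Measurable.expSup {α : Type*} [MeasurableSpace α] (n : ℕ) {f g : α → ℝ} (hf : Measurable f)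
    (hg : Measurable g) : Measurable fun a => expSup n (f a) (g a) := by
  unfold _root_.expSup bernCgf
  fun_prop

lemma ofReal_mul_expSup_card_le {n k : ℕ} (hn : 0 < n) (hk : k ≤ n) {p : ℝ}
    (hp : p ∈ Set.Icc (0 : ℝ) 1) :
    ENNReal.ofReal (p ^ k * (1 - p) ^ (n - k)) * expSup n p k ≤
      ENNReal.ofReal (2 * Real.sqrt n * ktProb k (n - k)) := by
  rw [expSup, ENNReal.mul_iSup]
  refine iSup_le fun t => ?_
  have hq : 0 ≤ 1 - p := sub_nonneg.mpr hp.2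
  rw [← ENNReal.ofReal_mul (mul_nonneg (pow_nonneg hp.1 _) (pow_nonneg hq _))]
  refine ENNReal.ofReal_le_ofReal ?_
  have hm := bernMgf_pos hp t
  have hsub : 1 - p * Real.exp t / (1 - p + p * Real.exp t) =
      (1 - p) / (1 - p + p * Real.exp t) := by
    field_simp
    ring
  have hnk : k + (n - k) = n := Nat.add_sub_cancel' hk
  have h := pow_mul_pow_le_ktProb (a := k) (b := n - k) (by omega)
    (t := p * Real.exp t / (1 - p + p * Real.exp t))
    ⟨div_nonneg (mul_nonneg hp.1 (Real.exp_pos _).le) hm.le,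
      (div_le_one hm).mpr (by linarith)⟩
  rw [hsub, hnk] at h
  refine le_of_eq_of_le ?_ h
  rw [Real.exp_sub, mul_comm (t : ℝ), Real.exp_nat_mul, Real.exp_nat_mul, exp_bernCgf hp, div_pow,
    div_pow, div_mul_div_comm, ← pow_add, hnk, mul_pow]
  ring

lemma exp_mul_le_of_mem_Icc {x : ℝ} (hx : x ∈ Set.Icc (0 : ℝ) 1) (t : ℝ) :
    Real.exp (t * x) ≤ x * Real.exp t + (1 - x) := by
  have h := convexOn_exp.2 (Set.mem_univ t) (Set.mem_univ 0) hx.1 (sub_nonneg.mpr hx.2) (by ring)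
  simpa [mul_comm] using h

lemma expSup_sum_le {n : ℕ} (p : ℝ) {x : Fin n → ℝ} (hx : ∀ i, x i ∈ Set.Icc (0 : ℝ) 1) :
    expSup n p (∑ i, x i) ≤ ∑ s ∈ (Finset.univ : Finset (Fin n)).powerset,
      ENNReal.ofReal (∏ i, if i ∈ s then x i else 1 - x i) * expSup n p s.card := by
  refine iSup_le fun t => ?_
  have hnonneg (s : Finset (Fin n)) : 0 ≤ ∏ i, if i ∈ s then x i else 1 - x i :=
    Finset.prod_nonneg fun i _ => by
      split_ifs
      exacts [(hx i).1, sub_nonneg.mpr (hx i).2]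
  have hprod : Real.exp (t * ∑ i, x i) ≤ ∑ s ∈ (Finset.univ : Finset (Fin n)).powerset,
      (∏ i, if i ∈ s then x i else 1 - x i) * Real.exp (t * s.card) := by
    rw [Finset.mul_sum, Real.exp_sum]
    refine (Finset.prod_le_prod (fun i _ => (Real.exp_pos _).le)
      fun i _ => exp_mul_le_of_mem_Icc (hx i) t).trans_eq ?_
    rw [Finset.prod_add]
    refine Finset.sum_congr rfl fun s _ => ?_
    rw [Finset.prod_ite, Finset.prod_mul_distrib, Finset.prod_const, mul_comm (t : ℝ),
      Real.exp_nat_mul, Finset.filter_mem_eq_inter, Finset.univ_inter, Finset.sdiff_eq_filter]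
    ring
  calc ENNReal.ofReal (Real.exp (t * ∑ i, x i - n * bernCgf p t))
      ≤ ENNReal.ofReal (∑ s ∈ (Finset.univ : Finset (Fin n)).powerset,
          (∏ i, if i ∈ s then x i else 1 - x i) *
            Real.exp (t * s.card - n * bernCgf p t)) := by
        refine ENNReal.ofReal_le_ofReal ?_
        simp only [Real.exp_sub, mul_div_assoc', ← Finset.sum_div]
        gcongr
    _ ≤ _ := by
        rw [ENNReal.ofReal_sum_of_nonneg fun s _ => mul_nonneg (hnonneg s) (Real.exp_pos _).le]
        refine Finset.sum_le_sum fun s _ => ?_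
        rw [ENNReal.ofReal_mul (hnonneg s)]
        gcongr
        exact le_iSup (fun t : ℚ => ENNReal.ofReal (Real.exp (t * s.card - n * bernCgf p t))) t

lemma integral_mem_Icc {α : Type*} [MeasurableSpace α] (μ : Measure α) [IsProbabilityMeasure μ]
    {f : α → ℝ} (hf01 : ∀ a, f a ∈ Set.Icc (0 : ℝ) 1) : ∫ a, f a ∂μ ∈ Set.Icc (0 : ℝ) 1 := by
  refine ⟨integral_nonneg fun a => (hf01 a).1, ?_⟩
  have h := integral_mono_of_nonneg (μ := μ) (Filter.Eventually.of_forall fun a => (hf01 a).1)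
    (integrable_const (1 : ℝ)) (Filter.Eventually.of_forall fun a => (hf01 a).2)
  simpa using h

lemma integrable_of_mem_Icc {α : Type*} [MeasurableSpace α] (μ : Measure α)
    [IsProbabilityMeasure μ] {f : α → ℝ} (hf : Measurable f)
    (hf01 : ∀ a, f a ∈ Set.Icc (0 : ℝ) 1) : Integrable f μ :=
  Integrable.of_mem_Icc 0 1 hf.aemeasurable (Filter.Eventually.of_forall hf01)

/-- Maurer's bound on the exponential moment of the relative entropy between the empirical mean
and the mean of a `[0, 1]`-valued function. -/
lemma lintegral_expSup_le {Z : Type*} [MeasurableSpace Z] (D : Measure Z) [IsProbabilityMeasure D]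
    {f : Z → ℝ} (hf : Measurable f) (hf01 : ∀ z, f z ∈ Set.Icc (0 : ℝ) 1) {n : ℕ} (hn : 0 < n) :
    ∫⁻ S, expSup n (∫ z, f z ∂D) (∑ i, f (S i)) ∂(Measure.pi fun _ : Fin n => D) ≤
      ENNReal.ofReal (2 * Real.sqrt n) := by
  set p := ∫ z, f z ∂D with hp_def
  have hp : p ∈ Set.Icc (0 : ℝ) 1 := integral_mem_Icc D hf01
  have hg01 (s : Finset (Fin n)) (S : Fin n → Z) :
      (∏ i, if i ∈ s then f (S i) else 1 - f (S i)) ∈ Set.Icc (0 : ℝ) 1 := by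
    have h01 (i : Fin n) : (if i ∈ s then f (S i) else 1 - f (S i)) ∈ Set.Icc (0 : ℝ) 1 := by
      have := hf01 (S i)
      split_ifs
      exacts [this, ⟨by linarith [this.2], by linarith [this.1]⟩]
    exact ⟨Finset.prod_nonneg fun i _ => (h01 i).1,
      Finset.prod_le_one (fun i _ => (h01 i).1) fun i _ => (h01 i).2⟩
  have hgm (s : Finset (Fin n)) :
      Measurable fun S : Fin n → Z => ∏ i, if i ∈ s then f (S i) else 1 - f (S i) := by
    refine Finset.measurable_fun_prod _ fun i _ => ?_
    split_ifs <;> fun_prop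
  have h_int (s : Finset (Fin n)) :
      ∫⁻ S, ENNReal.ofReal (∏ i, if i ∈ s then f (S i) else 1 - f (S i))
        ∂(Measure.pi fun _ : Fin n => D) = ENNReal.ofReal (p ^ s.card * (1 - p) ^ (n - s.card)) := by
    rw [← ofReal_integral_eq_lintegral_ofReal (integrable_of_mem_Icc _ (hgm s) (hg01 s))
      (Filter.Eventually.of_forall fun S => (hg01 s S).1)]
    have h := integral_fintype_prod_eq_prod (𝕜 := ℝ) (μ := fun _ : Fin n => D)
      (fun i z => if i ∈ s then f z else 1 - f z)
    have hi (i : Fin n) : ∫ z, (if i ∈ s then f z else 1 - f z) ∂D = if i ∈ s then p else 1 - p := by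
      split_ifs
      · rfl
      · rw [integral_sub (integrable_const _) (integrable_of_mem_Icc D hf hf01)]
        simp [hp_def]
    rw [h]
    simp only [hi]
    rw [Finset.prod_ite, Finset.prod_const, Finset.prod_const, Finset.filter_mem_eq_inter,
      Finset.univ_inter, ← Finset.sdiff_eq_filter, Finset.card_univ_sdiff, Fintype.card_fin]
  calc ∫⁻ S, expSup n p (∑ i, f (S i)) ∂(Measure.pi fun _ : Fin n => D)
      ≤ ∫⁻ S, ∑ s ∈ (Finset.univ : Finset (Fin n)).powerset,
          ENNReal.ofReal (∏ i, if i ∈ s then f (S i) else 1 - f (S i)) * expSup n p s.card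
          ∂(Measure.pi fun _ : Fin n => D) :=
        lintegral_mono fun S => expSup_sum_le p fun i => hf01 (S i)
    _ = ∑ s ∈ (Finset.univ : Finset (Fin n)).powerset,
          ENNReal.ofReal (p ^ s.card * (1 - p) ^ (n - s.card)) * expSup n p s.card := by
        rw [lintegral_finsetSum _ fun s _ => (hgm s).ennreal_ofReal.mul_const _]
        refine Finset.sum_congr rfl fun s _ => ?_
        rw [lintegral_mul_const _ (hgm s).ennreal_ofReal, h_int]
    _ ≤ ∑ s ∈ (Finset.univ : Finset (Fin n)).powerset,
          ENNReal.ofReal (2 * Real.sqrt n * ktProb s.card (n - s.card)) :=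
        Finset.sum_le_sum fun s _ =>
          ofReal_mul_expSup_card_le hn ((Finset.card_le_univ s).trans_eq (Fintype.card_fin n)) hp
    _ = ENNReal.ofReal (2 * Real.sqrt n) := by
        rw [← ENNReal.ofReal_sum_of_nonneg fun s _ =>
          mul_nonneg (by positivity) (ktProb_pos _ _).le, ← Finset.mul_sum]
        have h := sum_powerset_ktProb (Finset.univ : Finset (Fin n))
        rw [Finset.card_univ, Fintype.card_fin] at h
        rw [h, mul_one]

/-- The Donsker–Varadhan inequality. -/
lemma integral_le_integral_llr_add_log {W : Type*} [MeasurableSpace W] {Q P : Measure W}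
    [IsProbabilityMeasure Q] [IsProbabilityMeasure P] (hQP : Q ≪ P) (hllr : Integrable (llr Q P) Q)
    {h : W → ℝ} (hhm : Integrable h Q) (hexp : Integrable (fun w => Real.exp (h w)) P) :
    ∫ w, h w ∂Q ≤ ∫ w, llr Q P w ∂Q + Real.log (∫ w, Real.exp (h w) ∂P) := by
  have := isProbabilityMeasure_tilted hexp
  have hac := hQP.trans (absolutelyContinuous_tilted hexp)
  have h1 := integral_llr_tilted_right hQP hhm hexp hllr
  have h2 := InformationTheory.toReal_klDiv_of_measure_eq hac (by simp)
  have h3 : 0 ≤ (InformationTheory.klDiv Q (P.tilted h)).toReal := ENNReal.toReal_nonneg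
  linarith

lemma bernKL_self {x : ℝ} : bernKL x x = 0 := by
  have h (y : ℝ) : y * Real.log (y / y) = 0 := by
    rcases eq_or_ne y 0 with rfl | hy
    · simp
    · simp [div_self hy]
  rw [bernKL, if_neg (by tauto), h, h]
  simp

lemma le_klInv_of_bernKL_le {x y : ℝ} {b : ℝ≥0∞} (hy : y ∈ Set.Icc x 1) (h : bernKL x y ≤ b) :
    y ≤ klInv x b :=
  le_csSup ⟨1, fun _ hz => hz.1.2⟩ ⟨hy, h⟩

lemma le_klInv_self {x : ℝ} {b : ℝ≥0∞} (hx : x ≤ 1) : x ≤ klInv x b :=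
  le_klInv_of_bernKL_le ⟨le_rfl, hx⟩ (bernKL_self.trans_le zero_le)

lemma klInv_top {x : ℝ} (hx : x ≤ 1) : 1 ≤ klInv x ⊤ :=
  le_klInv_of_bernKL_le ⟨hx, le_rfl⟩ le_top

lemma bernKL_le_ofReal {x p c : ℝ} (hx : 0 ≤ x) (hxp : x < p) (hp1 : p ≤ 1)
    (hc : ∀ t : ℝ, t * x - bernCgf p t ≤ c) : bernKL x p ≤ ENNReal.ofReal c := by
  have hp0 : 0 < p := hx.trans_lt hxp
  rcases eq_or_lt_of_le hp1 with rfl | hp1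
  · exfalso
    have h := hc (-(|c| + 1) / (1 - x))
    have hx' : (1 - x) ≠ 0 := by linarith
    rw [bernCgf, sub_self, zero_add, one_mul, Real.log_exp] at h
    have h2 : -(|c| + 1) / (1 - x) * x - -(|c| + 1) / (1 - x) = |c| + 1 := by
      field_simp
      ring
    linarith [le_abs_self c]
  rw [bernKL, if_neg (by rintro (h | h) <;> linarith [h.1])]
  refine ENNReal.ofReal_le_ofReal ?_
  rcases eq_or_lt_of_le hx with rfl | hx
  · simp only [zero_mul, zero_add, sub_zero, one_mul, one_div, Real.log_inv]
    have hlim : Filter.Tendsto (fun t => t * 0 - bernCgf p t) Filter.atBot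
        (nhds (0 - Real.log (1 - p + p * 0))) := by
      simp only [mul_zero _, bernCgf]
      refine tendsto_const_nhds.sub (Filter.Tendsto.log ?_ (by simp; linarith))
      simpa using (Real.tendsto_exp_atBot.const_mul p).const_add (1 - p)
    have h := le_of_tendsto' hlim hc
    simpa using h
  · have hq : 0 < 1 - p := by linarith
    have hy : 0 < 1 - x := by linarith
    have h := hc (Real.log (x / p) - Real.log ((1 - x) / (1 - p)))
    rw [bernCgf, Real.exp_sub, Real.exp_log (by positivity), Real.exp_log (by positivity)] at h
    have h2 : 1 - p + p * (x / p / ((1 - x) / (1 - p))) = ((1 - x) / (1 - p))⁻¹ := by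
      field_simp
      ring
    rw [h2, Real.log_inv] at h
    linarith

lemma integral_bernCgf_le {W : Type*} [MeasurableSpace W] (Q : Measure W) [IsProbabilityMeasure Q]
    {L : W → ℝ} (hL : Measurable L) (hL01 : ∀ w, L w ∈ Set.Icc (0 : ℝ) 1) (t : ℝ) :
    Integrable (fun w => bernCgf (L w) t) Q ∧
      ∫ w, bernCgf (L w) t ∂Q ≤ bernCgf (∫ w, L w ∂Q) t := by
  have h_int : Integrable (fun w => bernCgf (L w) t) Q := by
    refine Integrable.of_bound (C := |t|) ?_
      (Filter.Eventually.of_forall fun w => abs_bernCgf_le (hL01 w) t)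
    unfold bernCgf
    exact Measurable.aestronglyMeasurable (by fun_prop)
  refine ⟨h_int, ?_⟩
  have hLi := integrable_of_mem_Icc Q hL hL01
  set m := 1 - (∫ w, L w ∂Q) + (∫ w, L w ∂Q) * Real.exp t with hm_def
  have hm : 0 < m := bernMgf_pos (integral_mem_Icc Q hL01) t
  have hsub : Integrable (fun w => 1 - L w) Q := (integrable_const _).sub hLi
  have hmgf : Integrable (fun w => 1 - L w + L w * Real.exp t) Q := hsub.add (hLi.mul_const _)
  have hdiv : Integrable (fun w => (1 - L w + L w * Real.exp t - m) / m) Q :=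
    (hmgf.sub (integrable_const _)).div_const _
  have hmean : ∫ w, (1 - L w + L w * Real.exp t) ∂Q = m := by
    rw [integral_add hsub (hLi.mul_const _),
      integral_sub (integrable_const _) hLi, integral_mul_const]
    simp [hm_def]
  calc ∫ w, bernCgf (L w) t ∂Q
      ≤ ∫ w, (Real.log m + (1 - L w + L w * Real.exp t - m) / m) ∂Q :=
        integral_mono h_int ((integrable_const _).add hdiv)
          fun w => log_le_log_add_div (bernMgf_pos (hL01 w) t) hm
    _ = Real.log m := by
        rw [integral_add (integrable_const _) hdiv,
          integral_div, integral_sub hmgf (integrable_const _), hmean]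
        simp

/-- The deterministic part of the PAC-Bayes argument: a bound on the prior exponential moment of
the relative entropy gives the risk certificate for every posterior. -/
lemma integral_le_klInv_of_lintegral_expSup_le {W : Type*} [MeasurableSpace W] {P Q : Measure W}
    [IsProbabilityMeasure P] [IsProbabilityMeasure Q] {L E : W → ℝ} (hL : Measurable L)
    (hL01 : ∀ w, L w ∈ Set.Icc (0 : ℝ) 1) (hE : Measurable E)
    (hE01 : ∀ w, E w ∈ Set.Icc (0 : ℝ) 1) {n : ℕ} (hn : 0 < n) {c : ℝ} (hc : 0 < c)
    (h : ∫⁻ w, expSup n (L w) (n * E w) ∂P ≤ ENNReal.ofReal c) :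
    ∫ w, L w ∂Q ≤
      klInv (∫ w, E w ∂Q) ((KLdiv Q P + ENNReal.ofReal (Real.log c)) / (n : ℝ≥0∞)) := by
  have hx := integral_mem_Icc Q hE01
  have hp := integral_mem_Icc Q hL01
  have hn' : (0 : ℝ) < n := by exact_mod_cast hn
  by_cases hKL : Q ≪ P ∧ Integrable (llr Q P) Q
  swap
  · rw [KLdiv, if_neg hKL, top_add, ENNReal.top_div_of_ne_top (ENNReal.natCast_ne_top n)]
    exact hp.2.trans (klInv_top hx.2)
  rcases le_or_gt (∫ w, L w ∂Q) (∫ w, E w ∂Q) with hle | hlt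
  · exact hle.trans (le_klInv_self hx.2)
  refine le_klInv_of_bernKL_le ⟨hlt.le, hp.2⟩ ?_
  have hbound : (ENNReal.ofReal ((∫ w, llr Q P w ∂Q + Real.log c) / n)) ≤
      (KLdiv Q P + ENNReal.ofReal (Real.log c)) / (n : ℝ≥0∞) := by
    rw [KLdiv, if_pos hKL, ENNReal.ofReal_div_of_pos hn', ENNReal.ofReal_natCast]
    gcongr
    exact ENNReal.ofReal_add_le
  refine (bernKL_le_ofReal hx.1 hlt hp.2 ?_).trans hbound
  refine isClosed_property Rat.denseRange_cast
    (isClosed_le ((continuous_id.mul continuous_const).sub (continuous_bernCgf hp))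
      continuous_const) fun t => ?_
  obtain ⟨hcgf, hjensen⟩ := integral_bernCgf_le Q hL hL01 t
  have hEQ := integrable_of_mem_Icc Q hE hE01
  have hhm : Measurable fun w => (t : ℝ) * (n * E w) - n * bernCgf (L w) t := by
    unfold bernCgf
    fun_prop
  have hlint : ∫⁻ w, ENNReal.ofReal (Real.exp (t * (n * E w) - n * bernCgf (L w) t)) ∂P ≤
      ENNReal.ofReal c :=
    (lintegral_mono fun w => le_iSup (fun t : ℚ =>
      ENNReal.ofReal (Real.exp (t * (n * E w) - n * bernCgf (L w) t))) t).trans h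
  have hexp : Integrable (fun w => Real.exp (t * (n * E w) - n * bernCgf (L w) t)) P :=
    (lintegral_ofReal_ne_top_iff_integrable hhm.exp.aestronglyMeasurable
      (Filter.Eventually.of_forall fun w => (Real.exp_pos _).le)).mp
      (hlint.trans_lt ENNReal.ofReal_lt_top).ne
  have hexp_le : ∫ w, Real.exp (t * (n * E w) - n * bernCgf (L w) t) ∂P ≤ c := by
    rw [← ENNReal.ofReal_le_ofReal_iff hc.le, ofReal_integral_eq_lintegral_ofReal hexp
      (Filter.Eventually.of_forall fun w => (Real.exp_pos _).le)]
    exact hlint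
  have hl1 : Integrable (fun w => (t : ℝ) * (n * E w)) Q := (hEQ.const_mul _).const_mul _
  have hDV := integral_le_integral_llr_add_log hKL.1 hKL.2 (hl1.sub (hcgf.const_mul n)) hexp
  have hlog := Real.log_le_log (integral_exp_pos hexp) hexp_le
  simp only [Pi.sub_apply] at hDV
  rw [integral_sub hl1 (hcgf.const_mul n), integral_const_mul, integral_const_mul,
    integral_const_mul] at hDV
  rw [le_div_iff₀ hn']
  have := mul_le_mul_of_nonneg_left hjensen hn'.le
  linarith

/-- With probability at least `1 - δ`, the prior exponential moment of the relative entropy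
between empirical and population losses is at most `2 √n / δ`. -/
lemma one_sub_le_measure_lintegral_expSup_le {Z W : Type*} [MeasurableSpace Z] [MeasurableSpace W]
    (D : Measure Z) [IsProbabilityMeasure D] {l : W → Z → ℝ}
    (hl : Measurable (Function.uncurry l)) (hl01 : ∀ w z, l w z ∈ Set.Icc (0 : ℝ) 1)
    {n : ℕ} (hn : 0 < n) {δ : ℝ} (hδ : 0 < δ) (P : Measure W) [IsProbabilityMeasure P] :
    ENNReal.ofReal (1 - δ) ≤ (Measure.pi fun _ : Fin n => D)
      {S | ∫⁻ w, expSup n (∫ z, l w z ∂D) (∑ i, l w (S i)) ∂P ≤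
        ENNReal.ofReal (2 * Real.sqrt n / δ)} := by
  have hc : 0 < 2 * Real.sqrt n / δ := by positivity
  have hL : Measurable fun w => ∫ z, l w z ∂D :=
    (hl.stronglyMeasurable.integral_prod_right' (ν := D)).measurable
  have hsum : Measurable fun q : (Fin n → Z) × W => ∑ i, l q.2 (q.1 i) :=
    Finset.measurable_fun_sum _ fun i _ =>
      hl.comp (measurable_snd.prodMk ((measurable_pi_apply i).comp measurable_fst))
  have hL2 : Measurable fun q : (Fin n → Z) × W => ∫ z, l q.2 z ∂D := hL.comp measurable_snd
  have hG : Measurable fun q : (Fin n → Z) × W =>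
      expSup n (∫ z, l q.2 z ∂D) (∑ i, l q.2 (q.1 i)) :=
    Measurable.expSup n hL2 hsum
  have hΦ : Measurable fun S : Fin n → Z =>
      ∫⁻ w, expSup n (∫ z, l w z ∂D) (∑ i, l w (S i)) ∂P := hG.lintegral_prod_right'
  have h_int : ∫⁻ S, ∫⁻ w, expSup n (∫ z, l w z ∂D) (∑ i, l w (S i)) ∂P
      ∂(Measure.pi fun _ : Fin n => D) ≤ ENNReal.ofReal (2 * Real.sqrt n) := by
    rw [lintegral_lintegral_swap hG.aemeasurable]
    calc _ ≤ ∫⁻ _, ENNReal.ofReal (2 * Real.sqrt n) ∂P :=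
          lintegral_mono fun w =>
            lintegral_expSup_le D (hl.comp measurable_prodMk_left) (hl01 w) hn
      _ = ENNReal.ofReal (2 * Real.sqrt n) := by simp
  set bad : Set (Fin n → Z) := {S | ENNReal.ofReal (2 * Real.sqrt n / δ) ≤
    ∫⁻ w, expSup n (∫ z, l w z ∂D) (∑ i, l w (S i)) ∂P}
  have hbad : (Measure.pi fun _ : Fin n => D) bad ≤ ENNReal.ofReal δ := by
    refine (meas_ge_le_lintegral_div hΦ.aemeasurable (ENNReal.ofReal_pos.mpr hc).ne'
      ENNReal.ofReal_ne_top).trans ((ENNReal.div_le_div_right h_int _).trans_eq ?_)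
    rw [← ENNReal.ofReal_div_of_pos hc]
    congr 1
    field_simp
  have hmeas : MeasurableSet bad := measurableSet_le measurable_const hΦ
  calc ENNReal.ofReal (1 - δ) = 1 - ENNReal.ofReal δ := by
        rw [ENNReal.ofReal_sub _ hδ.le, ENNReal.ofReal_one]
    _ ≤ 1 - (Measure.pi fun _ : Fin n => D) bad := tsub_le_tsub_left hbad 1
    _ = (Measure.pi fun _ : Fin n => D) badᶜ := (prob_compl_eq_one_sub hmeas).symm
    _ ≤ _ := by
        refine measure_mono fun S hS => ?_
        have hS' := lt_of_not_ge (Set.notMem_ofPred_iff.mp hS)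
        exact hS'.le

/-- Risk certificate via the inverted kl bound: with probability at least `1 - δ` over
the draw of an i.i.d. sample `S ∼ Dⁿ`, simultaneously for all posteriors `Q`,
`L(Q) ≤ kl⁻¹(L̂_S(Q), (KL(Q‖P) + log(2√n/δ))/n)`. -/
theorem risk_certificate_klInv
    {Z W : Type*} [MeasurableSpace Z] [MeasurableSpace W]
    (D : Measure Z) [IsProbabilityMeasure D]
    (l : W → Z → ℝ) (hl : Measurable (Function.uncurry l))
    (hl01 : ∀ w z, l w z ∈ Set.Icc (0 : ℝ) 1)
    (n : ℕ) (hn : 1 ≤ n) (δ : ℝ) (hδ : δ ∈ Set.Ioo (0 : ℝ) 1)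
    (P : Measure W) [IsProbabilityMeasure P] :
    ENNReal.ofReal (1 - δ) ≤
      (Measure.pi fun _ : Fin n => D)
        {S | ∀ Q : Measure W, IsProbabilityMeasure Q →
          (∫ w, ∫ z, l w z ∂D ∂Q) ≤
            klInv (∫ w, (n : ℝ)⁻¹ * ∑ i, l w (S i) ∂Q)
              ((KLdiv Q P + ENNReal.ofReal (Real.log (2 * Real.sqrt n / δ))) / (n : ℝ≥0∞))} := by
  have hn' : (0 : ℝ) < n := by exact_mod_cast hn
  have hL : Measurable fun w => ∫ z, l w z ∂D :=
    (hl.stronglyMeasurable.integral_prod_right' (ν := D)).measurable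
  refine (one_sub_le_measure_lintegral_expSup_le D hl hl01 hn hδ.1 P).trans (measure_mono ?_)
  intro S hS Q hQ
  have hE : Measurable fun w => (n : ℝ)⁻¹ * ∑ i, l w (S i) :=
    (Finset.measurable_fun_sum _ fun i _ => hl.comp measurable_prodMk_right).const_mul _
  have hE01 (w : W) : (n : ℝ)⁻¹ * ∑ i, l w (S i) ∈ Set.Icc (0 : ℝ) 1 := by
    refine ⟨mul_nonneg (by positivity) (Finset.sum_nonneg fun i _ => (hl01 w (S i)).1), ?_⟩
    rw [inv_mul_le_one₀ hn']
    simpa using Finset.sum_le_card_nsmul Finset.univ (fun i => l w (S i)) 1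
      fun i _ => (hl01 w (S i)).2
  have hδ0 : 0 < δ := hδ.1
  refine integral_le_klInv_of_lintegral_expSup_le hL (fun w => integral_mem_Icc D (hl01 w)) hE
    hE01 hn (by positivity) ?_
  simp only [mul_inv_cancel_left₀ hn'.ne']
  exact hS
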